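/- arXiv:1002.5045 — 2 statements merged into one kernel-verified Lean document; each statement's English description precedes it below -/
import Mathlib

section
/- Let N_{μν} : ℝ → ℝ for μ, ν ∈ {0,1,2,3} be C¹ functions with N_{μν} = N_{νμ}, and let a₁, a₂, a₃ : ℝ → ℝ be continuous. Suppose that for every test function f : ℝ⁴ → ℝ the following hold: ∫_ℝ [ (−N₀₀′(t) + Σᵢ aᵢ(t)N_{i0}(t))·f(t,0) + Σᵢ N_{i0}(t)·(∂ᵢf)(t,0) ] dt = 0, and for each j ∈ {1,2,3}, ∫_ℝ [ (−N_{0j}′(t) + Σᵢ aᵢ(t)N_{ij}(t) + a_j(t)N₀₀(t))·f(t,0) + Σᵢ N_{ij}(t)·(∂ᵢf)(t,0) ] dt = 0. Then N_{i0} ≡ 0 and N_{ij} ≡ 0 for all i, j ∈ {1,2,3}, N₀₀ is constant, and a_j(t)·N₀₀(t) = 0 for all t and j. In particular, if N₀₀ is not the zero function, then a_j ≡ 0 for all j. -/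
open MeasureTheory

/-- The point (t, 0, 0, 0) of ℝ⁴. -/
noncomputable def worldlinePt (t : ℝ) : Fin 4 → ℝ := fun μ => if μ = 0 then t else 0

/-- A test function on ℝ⁴: smooth and compactly supported. -/
def IsTestFunction (f : (Fin 4 → ℝ) → ℝ) : Prop :=
  ContDiff ℝ (⊤ : ℕ∞) f ∧ HasCompactSupport f

/-- The space cutoff. -/
noncomputable def cutoffBump : ContDiffBump (0 : ℝ) := ⟨1, 2, one_pos, one_lt_two⟩

/-- The test function g(t) L(x) χ(x¹) χ(x²) χ(x³). -/
noncomputable def cutTest (g : ℝ → ℝ) (L : (Fin 4 → ℝ) → ℝ) (x : Fin 4 → ℝ) : ℝ :=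
  g (x 0) * L x * ∏ i : Fin 3, cutoffBump (x i.succ)

theorem cutTest_isTest (g : ℝ → ℝ) (hg : ContDiff ℝ (⊤ : ℕ∞) g) (hc : HasCompactSupport g)
    (L : (Fin 4 → ℝ) → ℝ) (hL : ContDiff ℝ (⊤ : ℕ∞) L) : IsTestFunction (cutTest g L) := by
  constructor
  · unfold cutTest
    refine ContDiff.mul (ContDiff.mul (hg.comp (contDiff_apply ℝ ℝ 0)) hL) ?_
    refine contDiff_prod fun i _ => ?_
    exact cutoffBump.contDiff.comp (contDiff_apply ℝ ℝ i.succ)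
  · refine HasCompactSupport.intro (K := Set.pi Set.univ
      (Fin.cons (tsupport g) (fun _ : Fin 3 => tsupport cutoffBump) : Fin 4 → Set ℝ)) ?_ ?_
    · refine isCompact_univ_pi fun i => ?_
      refine Fin.cases ?_ (fun i => ?_) i
      · simpa using hc.isCompact
      · simpa using cutoffBump.hasCompactSupport.isCompact
    · intro x hx
      simp only [Set.mem_pi, Set.mem_univ, true_imp_iff, not_forall] at hx
      obtain ⟨i, hi⟩ := hx
      revert hi
      refine Fin.cases ?_ (fun i => ?_) i
      · intro h
        have : g (x 0) = 0 := image_eq_zero_of_notMem_tsupport (by simpa using h)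
        simp [cutTest, this]
      · intro h
        have : cutoffBump (x i.succ) = 0 := image_eq_zero_of_notMem_tsupport (by simpa using h)
        unfold cutTest
        rw [Finset.prod_eq_zero (Finset.mem_univ i) this, mul_zero]

theorem cutTest_eventually (g : ℝ → ℝ) (L : (Fin 4 → ℝ) → ℝ) (t : ℝ) :
    cutTest g L =ᶠ[nhds (worldlinePt t)] fun x => g (x 0) * L x := by
  have h : ∀ i : Fin 3, ∀ᶠ x in nhds (worldlinePt t), cutoffBump (x i.succ) = 1 := by
    intro i
    have hc : Filter.Tendsto (fun x : Fin 4 → ℝ => x i.succ) (nhds (worldlinePt t)) (nhds 0) := by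
      have := (continuous_apply (A := fun _ : Fin 4 => ℝ) i.succ).tendsto (worldlinePt t)
      simpa [worldlinePt] using this
    exact hc.eventually cutoffBump.eventuallyEq_one
  filter_upwards [Filter.eventually_all.2 h] with x hx
  simp [cutTest, hx]

theorem cutTest_val (g : ℝ → ℝ) (L : (Fin 4 → ℝ) → ℝ) (t : ℝ) :
    cutTest g L (worldlinePt t) = g t * L (worldlinePt t) := by
  have := (cutTest_eventually g L t).eq_of_nhds
  simpa [worldlinePt] using this

theorem cutTest_fderiv (g : ℝ → ℝ) (hg : ContDiff ℝ (⊤ : ℕ∞) g)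
    (L : (Fin 4 → ℝ) → ℝ) (hL : ContDiff ℝ (⊤ : ℕ∞) L) (t : ℝ) (i : Fin 3) :
    fderiv ℝ (cutTest g L) (worldlinePt t) (Pi.single i.succ 1) =
      g t * fderiv ℝ L (worldlinePt t) (Pi.single i.succ 1) := by
  rw [(cutTest_eventually g L t).fderiv_eq]
  have hL' : HasFDerivAt L (fderiv ℝ L (worldlinePt t)) (worldlinePt t) :=
    ((hL.differentiable (by simp)) _).hasFDerivAt
  have hg' : HasFDerivAt g (fderiv ℝ g ((worldlinePt t) 0)) ((worldlinePt t) 0) :=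
    ((hg.differentiable (by simp)) _).hasFDerivAt
  have hp : HasFDerivAt (fun x : Fin 4 → ℝ => x 0)
      (ContinuousLinearMap.proj (R := ℝ) (φ := fun _ : Fin 4 => ℝ) 0) (worldlinePt t) :=
    hasFDerivAt_apply 0 _
  have h1 := (hg'.comp (worldlinePt t) hp).mul hL'
  have h2 := h1.fderiv
  simp only [Function.comp_def] at h2
  erw [h2]
  simp [worldlinePt]

theorem cont_zero (F : ℝ → ℝ) (hF : Continuous F)
    (h : ∀ g : ℝ → ℝ, ContDiff ℝ (⊤ : ℕ∞) g → HasCompactSupport g → ∫ t, g t * F t = 0) :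
    ∀ t, F t = 0 := by
  have h1 : ∀ᵐ t ∂(volume : Measure ℝ), F t = 0 :=
    ae_eq_zero_of_integral_contDiff_smul_eq_zero hF.locallyIntegrable h
  have h2 : F = fun _ => 0 := Continuous.ae_eq_iff_eq volume hF continuous_const |>.1 h1
  exact fun t => congrFun h2 t

theorem key_lemma (A : ℝ → ℝ) (B : Fin 3 → ℝ → ℝ) (hA : Continuous A)
    (hB : ∀ i, Continuous (B i))
    (h : ∀ f : (Fin 4 → ℝ) → ℝ, IsTestFunction f →
      ∫ t : ℝ, (A t * f (worldlinePt t) +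
        ∑ i : Fin 3, B i t * fderiv ℝ f (worldlinePt t) (Pi.single i.succ 1)) = 0) :
    (∀ t, A t = 0) ∧ ∀ i t, B i t = 0 := by
  constructor
  · refine cont_zero A hA fun g hg hc => ?_
    have := h _ (cutTest_isTest g hg hc (fun _ => 1) contDiff_const)
    simp only [cutTest_val, cutTest_fderiv g hg _ contDiff_const] at this
    simpa [mul_comm] using this
  · intro k
    refine cont_zero (B k) (hB k) fun g hg hc => ?_
    have hL : ContDiff ℝ (⊤ : ℕ∞) (fun x : Fin 4 → ℝ => x k.succ) := contDiff_apply ℝ ℝ k.succ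
    have := h _ (cutTest_isTest g hg hc _ hL)
    have hd : ∀ t, fderiv ℝ (fun x : Fin 4 → ℝ => x k.succ) (worldlinePt t) =
        ContinuousLinearMap.proj (R := ℝ) (φ := fun _ : Fin 4 => ℝ) k.succ :=
      fun t => (hasFDerivAt_apply k.succ _).fderiv
    simp only [cutTest_val, cutTest_fderiv g hg _ hL, hd] at this
    simpa [mul_comm, worldlinePt, Pi.single_apply] using this

/-- Distributional conservation ∇^μ(N_{μν}(t) δ³(x)) = 0 in Fermi normal coordinates with
acceleration aᵢ(t) forces N_{i0} = N_{ij} = 0, constancy of N₀₀, and a_j N₀₀ = 0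
(geodesic motion when the mass N₀₀ is nonzero). -/
theorem stmt_3 (N : Fin 4 → Fin 4 → ℝ → ℝ) (a : Fin 3 → ℝ → ℝ)
    (hN : ∀ μ ν, ContDiff ℝ 1 (N μ ν)) (hNsym : ∀ μ ν, N μ ν = N ν μ)
    (ha : ∀ i, Continuous (a i))
    (h0 : ∀ f : (Fin 4 → ℝ) → ℝ, IsTestFunction f →
      ∫ t : ℝ, ((- deriv (N 0 0) t + ∑ i : Fin 3, a i t * N i.succ 0 t) * f (worldlinePt t) +
        ∑ i : Fin 3, N i.succ 0 t * fderiv ℝ f (worldlinePt t) (Pi.single i.succ 1)) = 0)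
    (hj : ∀ (j : Fin 3) (f : (Fin 4 → ℝ) → ℝ), IsTestFunction f →
      ∫ t : ℝ, ((- deriv (N 0 j.succ) t + ∑ i : Fin 3, a i t * N i.succ j.succ t
          + a j t * N 0 0 t) * f (worldlinePt t) +
        ∑ i : Fin 3, N i.succ j.succ t * fderiv ℝ f (worldlinePt t) (Pi.single i.succ 1)) = 0) :
    (∀ (i : Fin 3) (t : ℝ), N i.succ 0 t = 0) ∧
    (∀ (i j : Fin 3) (t : ℝ), N i.succ j.succ t = 0) ∧
    (∃ m : ℝ, ∀ t : ℝ, N 0 0 t = m) ∧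
    (∀ (j : Fin 3) (t : ℝ), a j t * N 0 0 t = 0) ∧
    ((∃ t : ℝ, N 0 0 t ≠ 0) → ∀ (j : Fin 3) (t : ℝ), a j t = 0) := by
  have hd : ∀ μ ν, Continuous (deriv (N μ ν)) := fun μ ν => (hN μ ν).continuous_deriv le_rfl
  have hc : ∀ μ ν, Continuous (N μ ν) := fun μ ν => (hN μ ν).continuous
  obtain ⟨A0, B0⟩ := key_lemma (fun t => - deriv (N 0 0) t + ∑ i : Fin 3, a i t * N i.succ 0 t)
    (fun i => N i.succ 0) (by fun_prop) (fun i => hc _ _) h0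
  have Hj := fun j => key_lemma (fun t => - deriv (N 0 j.succ) t +
    ∑ i : Fin 3, a i t * N i.succ j.succ t + a j t * N 0 0 t)
    (fun i => N i.succ j.succ) (by fun_prop) (fun i => hc _ _) (hj j)
  have hdz : ∀ t, deriv (N 0 0) t = 0 := by
    intro t
    have := A0 t
    simpa [B0] using this
  have hconst : ∀ t, N 0 0 t = N 0 0 0 := fun t =>
    is_const_of_deriv_eq_zero ((hN 0 0).differentiable (by simp)) hdz t 0
  have haN : ∀ (j : Fin 3) (t : ℝ), a j t * N 0 0 t = 0 := by
    intro j t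
    have h1 := (Hj j).1 t
    have h2 : N 0 j.succ = fun _ => 0 := by
      rw [hNsym]
      exact funext (B0 j)
    have h3 : ∀ i : Fin 3, N i.succ j.succ t = 0 := fun i => (Hj j).2 i t
    simpa [h2, h3] using h1
  refine ⟨B0, fun i j t => (Hj j).2 i t, ⟨_, hconst⟩, haN, ?_⟩
  rintro ⟨s, hs⟩ j t
  have := haN j t
  rw [hconst t, ← hconst s] at this
  exact (mul_eq_zero.1 this).resolve_right hs
end

section
/- Let N_{μν} : ℝ → ℝ for μ, ν ∈ {0,1,2,3} be C¹ functions with N_{μν} = N_{νμ}, and let N^{φ}, a₁, a₂, a₃, Φ₀, Φ₁, Φ₂, Φ₃ : ℝ → ℝ be continuous. Suppose that for every test function f : ℝ⁴ → ℝ the following hold: ∫_ℝ [ (−N₀₀′(t) + Σᵢ aᵢ(t)N_{i0}(t) + ½N^{φ}(t)Φ₀(t))·f(t,0) + Σᵢ N_{i0}(t)·(∂ᵢf)(t,0) ] dt = 0, and for each j ∈ {1,2,3}, ∫_ℝ [ (−N_{0j}′(t) + Σᵢ aᵢ(t)N_{ij}(t) + a_j(t)N₀₀(t) + ½N^{φ}(t)Φ_j(t))·f(t,0)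 + Σᵢ N_{ij}(t)·(∂ᵢf)(t,0) ] dt = 0. Then N_{i0} ≡ 0 and N_{ij} ≡ 0 for all i, j ∈ {1,2,3}, and for all t: N₀₀′(t) = ½N^{φ}(t)Φ₀(t) and N₀₀(t)·a_j(t) = −½N^{φ}(t)Φ_j(t) for each j. -/
open MeasureTheory

/-- A continuous function that annihilates all test functions on the line vanishes. -/
lemma aux_zero (A : ℝ → ℝ) (hA : Continuous A)
    (h : ∀ g : ℝ → ℝ, ContDiff ℝ (⊤ : ℕ∞) g → HasCompactSupport g → ∫ t, g t * A t = 0) :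
    ∀ t, A t = 0 := by
  have h1 : ∀ᵐ t ∂(volume : Measure ℝ), A t = 0 :=
    ae_eq_zero_of_integral_contDiff_smul_eq_zero hA.locallyIntegrable
      (fun g hg hc => by simpa [smul_eq_mul] using h g hg hc)
  have h2 : A = fun _ => (0 : ℝ) :=
    (Continuous.ae_eq_iff_eq (volume : Measure ℝ) hA continuous_const).1 h1
  intro t
  exact congrFun h2 t

/-- Product test functions. -/
lemma aux_test (g : ℝ → ℝ) (h : (Fin 3 → ℝ) → ℝ) (hg : ContDiff ℝ (⊤ : ℕ∞) g)
    (hgc : HasCompactSupport g) (hh : ContDiff ℝ (⊤ : ℕ∞) h) (hhc : HasCompactSupport h) :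
    IsTestFunction (fun x : Fin 4 → ℝ => g (x 0) * h (fun i : Fin 3 => x i.succ)) := by
  refine ⟨by fun_prop, ?_⟩
  have hK : IsCompact ((fun p : ℝ × (Fin 3 → ℝ) => (Fin.cons p.1 p.2 : Fin 4 → ℝ)) ''
      (tsupport g ×ˢ tsupport h)) := by
    refine (IsCompact.prod hgc hhc).image ?_
    refine continuous_pi fun i => ?_
    refine Fin.cases ?_ (fun j => ?_) i
    · simpa using continuous_fst
    · simp only [Fin.cons_succ]
      fun_prop
  refine HasCompactSupport.intro hK ?_
  intro x hx
  by_contra hne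
  apply hx
  refine ⟨(x 0, fun i => x i.succ), ⟨?_, ?_⟩, ?_⟩
  · exact subset_tsupport _ (left_ne_zero_of_mul hne)
  · exact subset_tsupport _ (right_ne_zero_of_mul hne)
  · exact Fin.cons_self_tail x

lemma aux_fderiv (g : ℝ → ℝ) (h : (Fin 3 → ℝ) → ℝ) (hg : ContDiff ℝ (⊤ : ℕ∞) g)
    (hh : ContDiff ℝ (⊤ : ℕ∞) h) (t : ℝ) (i : Fin 3) :
    fderiv ℝ (fun x : Fin 4 → ℝ => g (x 0) * h (fun i : Fin 3 => x i.succ)) (worldlinePt t)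
      (Pi.single i.succ 1) = g t * fderiv ℝ h 0 (Pi.single i 1) := by
  have hw : (fun i : Fin 3 => worldlinePt t i.succ) = 0 := by
    ext i; simp [worldlinePt, Fin.succ_ne_zero]
  have hw0 : worldlinePt t 0 = t := by simp [worldlinePt]
  have e0 : HasFDerivAt (fun x : Fin 4 → ℝ => x 0)
      (ContinuousLinearMap.proj (R := ℝ) (φ := fun _ : Fin 4 => ℝ) 0) (worldlinePt t) :=
    (ContinuousLinearMap.proj (R := ℝ) (φ := fun _ : Fin 4 => ℝ) 0).hasFDerivAt
  have e1 : HasFDerivAt (fun (x : Fin 4 → ℝ) (i : Fin 3) => x i.succ)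
      (ContinuousLinearMap.pi fun i : Fin 3 =>
        ContinuousLinearMap.proj (R := ℝ) (φ := fun _ : Fin 4 => ℝ) i.succ) (worldlinePt t) :=
    (ContinuousLinearMap.pi fun i : Fin 3 =>
        ContinuousLinearMap.proj (R := ℝ) (φ := fun _ : Fin 4 => ℝ) i.succ).hasFDerivAt
  have dg : HasFDerivAt g (fderiv ℝ g (worldlinePt t 0)) (worldlinePt t 0) :=
    (hg.differentiable (by simp)).differentiableAt.hasFDerivAt
  have dh : HasFDerivAt h (fderiv ℝ h (fun i : Fin 3 => worldlinePt t i.succ))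
      (fun i : Fin 3 => worldlinePt t i.succ) :=
    (hh.differentiable (by simp)).differentiableAt.hasFDerivAt
  have d := (dg.comp (worldlinePt t) e0).mul (dh.comp (worldlinePt t) e1)
  have hd : HasFDerivAt (fun x : Fin 4 → ℝ => g (x 0) * h (fun i : Fin 3 => x i.succ)) _
    (worldlinePt t) := d
  rw [hd.fderiv]
  have hs : (fun j : Fin 3 => (Pi.single i.succ (1 : ℝ) : Fin 4 → ℝ) j.succ)
      = Pi.single i (1 : ℝ) := by
    ext j; simp [Pi.single_apply]
  have hs' : (ContinuousLinearMap.pi fun i : Fin 3 =>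
        ContinuousLinearMap.proj (R := ℝ) (φ := fun _ : Fin 4 => ℝ) i.succ)
        (Pi.single i.succ (1 : ℝ)) = Pi.single i (1 : ℝ) := hs
  have hz : (Pi.single i.succ (1 : ℝ) : Fin 4 → ℝ) 0 = 0 := by
    simp [Pi.single_apply, (Fin.succ_ne_zero i).symm]
  simp [hs', hw, hw0, hz]

/-- The key separation lemma. -/
lemma aux_key (A : ℝ → ℝ) (B : Fin 3 → ℝ → ℝ) (hA : Continuous A) (hB : ∀ i, Continuous (B i))
    (H : ∀ f : (Fin 4 → ℝ) → ℝ, IsTestFunction f →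
      ∫ t : ℝ, (A t * f (worldlinePt t) +
        ∑ i : Fin 3, B i t * fderiv ℝ f (worldlinePt t) (Pi.single i.succ 1)) = 0) :
    (∀ t, A t = 0) ∧ ∀ i t, B i t = 0 := by
  have hw : ∀ t, (fun i : Fin 3 => worldlinePt t i.succ) = 0 := by
    intro t; ext i; simp [worldlinePt, Fin.succ_ne_zero]
  have hw0 : ∀ t, worldlinePt t 0 = t := by intro t; simp [worldlinePt]
  have H' : ∀ (h : (Fin 3 → ℝ) → ℝ), ContDiff ℝ (⊤ : ℕ∞) h → HasCompactSupport h →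
      ∀ t, A t * h 0 + ∑ i : Fin 3, B i t * fderiv ℝ h 0 (Pi.single i 1) = 0 := by
    intro h hh hhc
    refine aux_zero _ (by fun_prop) ?_
    intro g hg hgc
    have := H _ (aux_test g h hg hgc hh hhc)
    rw [← this]
    congr 1
    ext t
    simp only [aux_fderiv g h hg hh, hw, hw0]
    rw [mul_add, Finset.mul_sum]
    congr 1
    · ring
    · exact Finset.sum_congr rfl fun i _ => by ring
  let ψ : ContDiffBump (0 : Fin 3 → ℝ) := ⟨1, 2, by norm_num, by norm_num⟩
  have hψ0 : ψ 0 = 1 := ψ.eventuallyEq_one.self_of_nhds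
  refine ⟨fun t => ?_, fun k t => ?_⟩
  · have h1 := H' ψ ψ.contDiff ψ.hasCompactSupport t
    have h2 : fderiv ℝ (ψ : (Fin 3 → ℝ) → ℝ) 0 = 0 := by
      rw [ψ.eventuallyEq_one.fderiv_eq]
      exact fderiv_const_apply (1 : ℝ)
    simpa [h2, hψ0] using h1
  · have hc : ContDiff ℝ (⊤ : ℕ∞) (ψ : (Fin 3 → ℝ) → ℝ) := ψ.contDiff
    have h1 := H' (fun x => ψ x * x k) (by fun_prop) ψ.hasCompactSupport.mul_right t
    have h2 : fderiv ℝ (fun x : Fin 3 → ℝ => ψ x * x k) 0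
        = ContinuousLinearMap.proj (R := ℝ) (φ := fun _ : Fin 3 => ℝ) k := by
      have he : (fun x : Fin 3 → ℝ => ψ x * x k) =ᶠ[nhds 0]
          (ContinuousLinearMap.proj (R := ℝ) (φ := fun _ : Fin 3 => ℝ) k) := by
        filter_upwards [ψ.eventuallyEq_one] with x hx
        simp [hx]
      rw [he.fderiv_eq]
      exact ContinuousLinearMap.fderiv _
    simpa [h2, Pi.single_apply] using h1

/-- The distributional scalar-tensor Bianchi identity
∇^μ(N_{μν} δ³(x)) = −½ N^φ δ³(x) ∂_ν φ⁽⁰⁾ in Fermi normal coordinates (with acceleration aᵢ(t)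
and worldline scalar-field gradient Φ_μ(t)) yields N_{i0} = N_{ij} = 0 together with the
mass-evolution law N₀₀′ = ½ N^φ Φ₀ and the scalar force law N₀₀ a_j = −½ N^φ Φ_j. -/
theorem stmt_4 (N : Fin 4 → Fin 4 → ℝ → ℝ) (Nφ : ℝ → ℝ) (a : Fin 3 → ℝ → ℝ)
    (Φ : Fin 4 → ℝ → ℝ)
    (hN : ∀ μ ν, ContDiff ℝ 1 (N μ ν)) (hNsym : ∀ μ ν, N μ ν = N ν μ)
    (hNφ : Continuous Nφ) (ha : ∀ i, Continuous (a i)) (hΦ : ∀ μ, Continuous (Φ μ))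
    (h0 : ∀ f : (Fin 4 → ℝ) → ℝ, IsTestFunction f →
      ∫ t : ℝ, ((- deriv (N 0 0) t + ∑ i : Fin 3, a i t * N i.succ 0 t
          + (1 / 2) * Nφ t * Φ 0 t) * f (worldlinePt t) +
        ∑ i : Fin 3, N i.succ 0 t * fderiv ℝ f (worldlinePt t) (Pi.single i.succ 1)) = 0)
    (hj : ∀ (j : Fin 3) (f : (Fin 4 → ℝ) → ℝ), IsTestFunction f →
      ∫ t : ℝ, ((- deriv (N 0 j.succ) t + ∑ i : Fin 3, a i t * N i.succ j.succ t
          + a j t * N 0 0 t + (1 / 2) * Nφ t * Φ j.succ t) * f (worldlinePt t) +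
        ∑ i : Fin 3, N i.succ j.succ t * fderiv ℝ f (worldlinePt t) (Pi.single i.succ 1)) = 0) :
    (∀ (i : Fin 3) (t : ℝ), N i.succ 0 t = 0) ∧
    (∀ (i j : Fin 3) (t : ℝ), N i.succ j.succ t = 0) ∧
    (∀ t : ℝ, deriv (N 0 0) t = (1 / 2) * Nφ t * Φ 0 t) ∧
    (∀ (j : Fin 3) (t : ℝ), N 0 0 t * a j t = -(1 / 2) * Nφ t * Φ j.succ t) := by
  have hNc : ∀ μ ν, Continuous (N μ ν) := fun μ ν => (hN μ ν).continuous
  have hNd : ∀ μ ν, Continuous (deriv (N μ ν)) := fun μ ν => (hN μ ν).continuous_deriv (by simp)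
  obtain ⟨hA0, hB0⟩ := aux_key (fun t => - deriv (N 0 0) t + ∑ i : Fin 3, a i t * N i.succ 0 t
          + (1 / 2) * Nφ t * Φ 0 t) (fun i => N i.succ 0) (by fun_prop) (fun i => hNc _ _) h0
  have hk := fun j => aux_key (fun t => - deriv (N 0 j.succ) t
          + ∑ i : Fin 3, a i t * N i.succ j.succ t
          + a j t * N 0 0 t + (1 / 2) * Nφ t * Φ j.succ t) (fun i => N i.succ j.succ)
          (by fun_prop) (fun i => hNc _ _) (hj j)
  have hBj : ∀ (i j : Fin 3) (t : ℝ), N i.succ j.succ t = 0 := fun i j t => (hk j).2 i t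
  refine ⟨hB0, hBj, fun t => ?_, fun j t => ?_⟩
  · have := hA0 t
    simp only [hB0, mul_zero, Finset.sum_const_zero] at this
    linarith
  · have h1 := (hk j).1 t
    have h2 : N 0 j.succ = fun _ => 0 := by
      rw [hNsym]; exact funext (hB0 j)
    simp only [hBj, h2, mul_zero, Finset.sum_const_zero, deriv_const] at h1
    linarith
end
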